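/- Let f(G) = #Ind(P2, G) − #Ind(K3, G) + #Ind(Paw, G) + 2·#Ind(Diamond, G) + 4·#Ind(K4, G), where P2 is a single edge, K3 a triangle, Paw the 4-vertex graph consisting of a triangle with one pendant edge, Diamond the 4-vertex graph K4 minus one edge, and K4 the complete graph on 4 vertices. Then f(G) ≥ 0 for every finite simple graph G. -/

import Mathlib

open SimpleGraph

/-- The number of induced copies of `H` in `G`. -/
noncomputable def indCount {α β : Type*} (H : SimpleGraph α) (G : SimpleGraph β) : ℕ :=
  Nat.card {s : Finset β // Nonempty (H ≃g G.induce (s : Set β))}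

/-- The paw: a triangle `{0,1,2}` with the pendant edge `{0,3}`. -/
def pawGraph : SimpleGraph (Fin 4) :=
  SimpleGraph.fromRel (fun a b =>
    (a = 0 ∧ b = 1) ∨ (a = 0 ∧ b = 2) ∨ (a = 1 ∧ b = 2) ∨ (a = 0 ∧ b = 3))

/-- The diamond: `K₄` minus the edge `{2,3}`. -/
def diamondGraph : SimpleGraph (Fin 4) :=
  SimpleGraph.fromRel (fun a b =>
    (a = 0 ∧ b = 1) ∨ (a = 0 ∧ b = 2) ∨ (a = 1 ∧ b = 2) ∨ (a = 0 ∧ b = 3) ∨ (a = 1 ∧ b = 3))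

/-- An embedding of `H` into `G` is the choice of an induced copy of `H` in `G` together with an
isomorphism of `H` onto this copy. -/
noncomputable def embeddingEquivSigma {α β : Type*} [Finite α] (H : SimpleGraph α)
    (G : SimpleGraph β) :
    (H ↪g G) ≃ Σ s : {s : Finset β // Nonempty (H ≃g G.induce (s : Set β))},
      (H ≃g G.induce (s.1 : Set β)) := by
  refine (Equiv.ofBijective (fun x => (SimpleGraph.Embedding.induce (x.1.1 : Set β)).comp x.2.toEmbedding)
    ⟨?_, ?_⟩).symm
  · rintro ⟨⟨s, hs⟩, e⟩ ⟨⟨t, ht⟩, e'⟩ h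
    have hval : ∀ a, (e a : β) = e' a := fun a => DFunLike.congr_fun h a
    obtain rfl : s = t := by
      ext b
      constructor
      · intro hb
        obtain ⟨a, ha⟩ := e.surjective ⟨b, hb⟩
        have hab : (e a : β) = b := by rw [ha]
        rw [← hab, hval]
        exact (e' a).2
      · intro hb
        obtain ⟨a, ha⟩ := e'.surjective ⟨b, hb⟩
        have hab : (e' a : β) = b := by rw [ha]
        rw [← hab, ← hval]
        exact (e a).2
    obtain rfl : e = e' := by
      ext a
      exact hval a
    rfl
  · intro f
    let s : Finset β := (Set.finite_range f).toFinset
    have hmem : ∀ b, b ∈ (s : Set β) ↔ b ∈ Set.range f := by simp [s]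
    let e : H ≃g G.induce (s : Set β) :=
      { toEquiv := Equiv.ofBijective (fun a => ⟨f a, (hmem _).2 ⟨a, rfl⟩⟩)
          ⟨fun a b h => f.injective (congrArg Subtype.val h), fun ⟨b, hb⟩ => by
            obtain ⟨a, ha⟩ := (hmem b).1 hb
            exact ⟨a, Subtype.ext ha⟩⟩
        map_rel_iff' := f.map_rel_iff }
    exact ⟨⟨⟨s, ⟨e⟩⟩, e⟩, rfl⟩

theorem card_embedding_eq_card_aut_mul_indCount {α β : Type*} [Finite α] [Finite β]
    (H : SimpleGraph α) (G : SimpleGraph β) :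
    Nat.card (H ↪g G) = Nat.card (H ≃g H) * indCount H G := by
  classical
  have := Fintype.ofFinite {s : Finset β // Nonempty (H ≃g G.induce (s : Set β))}
  have hfin (s : {s : Finset β // Nonempty (H ≃g G.induce (s : Set β))}) :
      Finite (H ≃g G.induce (s.1 : Set β)) := DFunLike.finite _
  have hfiber (s : {s : Finset β // Nonempty (H ≃g G.induce (s : Set β))}) :
      Nat.card (H ≃g G.induce (s.1 : Set β)) = Nat.card (H ≃g H) := by
    obtain ⟨e⟩ := s.2
    exact Nat.card_congr
      { toFun := fun g => g.trans e.symm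
        invFun := fun g => g.trans e
        left_inv := fun g => by ext; simp
        right_inv := fun g => by ext; simp }
  rw [Nat.card_congr (embeddingEquivSigma H G), Nat.card_sigma, Finset.sum_congr rfl
    fun s _ => hfiber s, Finset.sum_const, indCount, smul_eq_mul, mul_comm, Finset.card_univ,
    ← Nat.card_eq_fintype_card]

theorem card_aut_top (n : ℕ) :
    Nat.card ((⊤ : SimpleGraph (Fin n)) ≃g (⊤ : SimpleGraph (Fin n))) = n.factorial := by
  have e : ((⊤ : SimpleGraph (Fin n)) ≃g (⊤ : SimpleGraph (Fin n))) ≃ Equiv.Perm (Fin n) :=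
    { toFun := fun g => g.toEquiv
      invFun := fun g => Iso.completeGraph g
      left_inv := fun g => by ext; rfl
      right_inv := fun g => by ext; rfl }
  rw [Nat.card_congr e, Nat.card_perm, Nat.card_fin]

theorem diamondGraph_adj_iff (i j : Fin 4) :
    diamondGraph.Adj i j ↔ i ≠ j ∧ ¬(i = 2 ∧ j = 3) ∧ ¬(i = 3 ∧ j = 2) := by
  simp only [diamondGraph, SimpleGraph.fromRel_adj]
  revert i j
  decide

theorem card_aut_diamondGraph : Nat.card (diamondGraph ≃g diamondGraph) = 4 := by
  have e : (diamondGraph ≃g diamondGraph) ≃ {p : Equiv.Perm (Fin 4) //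
      ∀ i j, (p i ≠ p j ∧ ¬(p i = 2 ∧ p j = 3) ∧ ¬(p i = 3 ∧ p j = 2)) ↔
        (i ≠ j ∧ ¬(i = 2 ∧ j = 3) ∧ ¬(i = 3 ∧ j = 2))} :=
    { toFun := fun g => ⟨g.toEquiv, fun i j => by
        rw [← diamondGraph_adj_iff, ← diamondGraph_adj_iff]
        exact g.map_rel_iff⟩
      invFun := fun p => ⟨p.1, fun {i j} => by simpa only [diamondGraph_adj_iff] using p.2 i j⟩
      left_inv := fun g => by ext; rfl
      right_inv := fun g => by ext; rfl }
  rw [Nat.card_congr e, Nat.card_eq_fintype_card]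
  decide +kernel

theorem Finset.card_le_natCard_of_forall_exists {α β : Type*} [Finite α] (s : Finset β) (g : α → β)
    (h : ∀ x ∈ s, ∃ y, g y = x) : s.card ≤ Nat.card α := by
  classical
  have := Fintype.ofFinite α
  calc s.card ≤ (Finset.univ.image g).card := Finset.card_le_card fun x hx => by
        simpa using h x hx
    _ ≤ Nat.card α := by
        rw [Nat.card_eq_fintype_card]
        exact Finset.card_image_le

section Counting

variable {V : Type*} [Fintype V] (G : SimpleGraph V) [DecidableRel G.Adj]

/-- The ordered pairs of adjacent vertices. -/
def adjPairs : Finset (V × V) := Finset.univ.filter fun p => G.Adj p.1 p.2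

/-- The common neighbours of a pair of vertices. -/
def commonNbrs (p : V × V) : Finset V := Finset.univ.filter fun v => G.Adj p.1 v ∧ G.Adj p.2 v

theorem card_adjPairs_le :
    (adjPairs G).card ≤ Nat.card ((⊤ : SimpleGraph (Fin 2)) ↪g G) := by
  have : Finite ((⊤ : SimpleGraph (Fin 2)) ↪g G) := DFunLike.finite _
  refine Finset.card_le_natCard_of_forall_exists _ (fun f => (f 0, f 1)) ?_
  rintro ⟨a, b⟩ hab
  replace hab : G.Adj a b := by simpa [adjPairs] using hab
  have hne := hab.ne
  exact ⟨⟨⟨![a, b], fun i j => by fin_cases i <;> fin_cases j <;> simp [hne, hne.symm]⟩,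
    fun {i j} => by fin_cases i <;> fin_cases j <;>
      first
      | exact iff_of_false G.irrefl (by decide)
      | exact iff_of_true hab (by decide)
      | exact iff_of_true hab.symm (by decide)⟩, rfl⟩

theorem card_triangle_embedding_le :
    Nat.card ((⊤ : SimpleGraph (Fin 3)) ↪g G) ≤ ∑ p ∈ adjPairs G, (commonNbrs G p).card := by
  have : Finite ((⊤ : SimpleGraph (Fin 3)) ↪g G) := DFunLike.finite _
  have := Fintype.ofFinite ((⊤ : SimpleGraph (Fin 3)) ↪g G)
  rw [← Finset.card_sigma, Nat.card_eq_fintype_card, ← Finset.card_univ]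
  refine Finset.card_le_card_of_injOn (fun f => ⟨(f 0, f 1), f 2⟩) ?_ ?_
  · intro f _
    simp [adjPairs, commonNbrs]
  · intro f _ g _ h
    simp only [Sigma.mk.injEq, Prod.mk.injEq, heq_eq_eq] at h
    ext i
    fin_cases i
    exacts [h.1.1, h.1.2, h.2]

theorem sum_card_offDiag_commonNbrs_le :
    ∑ p ∈ adjPairs G, (commonNbrs G p).offDiag.card ≤
      Nat.card (diamondGraph ↪g G) + Nat.card ((⊤ : SimpleGraph (Fin 4)) ↪g G) := by
  have : Finite (diamondGraph ↪g G) := DFunLike.finite _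
  have : Finite ((⊤ : SimpleGraph (Fin 4)) ↪g G) := DFunLike.finite _
  rw [← Finset.card_sigma, ← Nat.card_sum]
  refine Finset.card_le_natCard_of_forall_exists _
    (Sum.elim (fun f => ⟨(f 0, f 1), (f 2, f 3)⟩) (fun f => ⟨(f 0, f 1), (f 2, f 3)⟩)) ?_
  rintro ⟨⟨a, b⟩, ⟨c, d⟩⟩ h
  simp only [adjPairs, commonNbrs, Finset.mem_sigma, Finset.mem_offDiag, Finset.mem_filter,
    Finset.mem_univ, true_and] at h
  obtain ⟨hab, ⟨hac, hbc⟩, ⟨had, hbd⟩, hcd⟩ := h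
  have hinj : Function.Injective ![a, b, c, d] := fun i j => by
    have := hab.ne
    have := hac.ne
    have := hbc.ne
    have := had.ne
    have := hbd.ne
    fin_cases i <;> fin_cases j <;> simp [*, Ne.symm, eq_comm]
  by_cases h : G.Adj c d
  · exact ⟨Sum.inr ⟨⟨![a, b, c, d], hinj⟩, fun {i j} => by
      fin_cases i <;> fin_cases j <;> simp [*, G.adj_comm]⟩, rfl⟩
  · exact ⟨Sum.inl ⟨⟨![a, b, c, d], hinj⟩, fun {i j} => by
      rw [diamondGraph_adj_iff]
      fin_cases i <;> fin_cases j <;> simp [*, G.adj_comm]⟩, rfl⟩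

end Counting

/-- `f(G) = #Ind(P₂,G) − #Ind(K₃,G) + #Ind(Paw,G) + 2·#Ind(Diamond,G) + 4·#Ind(K₄,G) ≥ 0`
for every finite simple graph `G`. -/
theorem stmt5 {V : Type*} [Fintype V] (G : SimpleGraph V) :
    0 ≤ (indCount (⊤ : SimpleGraph (Fin 2)) G : ℤ)
          - (indCount (⊤ : SimpleGraph (Fin 3)) G : ℤ)
          + (indCount pawGraph G : ℤ)
          + 2 * (indCount diamondGraph G : ℤ)
          + 4 * (indCount (⊤ : SimpleGraph (Fin 4)) G : ℤ) := by
  classical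
  have h2 := card_adjPairs_le G
  have h3 := card_triangle_embedding_le G
  have h4 := sum_card_offDiag_commonNbrs_le G
  rw [card_embedding_eq_card_aut_mul_indCount, card_aut_top] at h2 h3
  rw [card_embedding_eq_card_aut_mul_indCount, card_embedding_eq_card_aut_mul_indCount,
    card_aut_top, card_aut_diamondGraph] at h4
  have key : ∑ p ∈ adjPairs G, (commonNbrs G p).card ≤
      3 * (adjPairs G).card + ∑ p ∈ adjPairs G, (commonNbrs G p).offDiag.card := by
    rw [mul_comm, ← smul_eq_mul, ← Finset.sum_const, ← Finset.sum_add_distrib]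
    refine Finset.sum_le_sum fun p _ => ?_
    rw [Finset.offDiag_card]
    obtain h | h := Nat.lt_or_ge (commonNbrs G p).card 2
    · omega
    · have := Nat.mul_le_mul_right (commonNbrs G p).card h
      omega
  simp only [Nat.factorial] at h2 h3 h4
  omega
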